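/- arXiv:1404.4391 — 9 statements merged into one kernel-verified Lean document; each statement's English description precedes it below -/
import Mathlib

section
/- The combined routing matrix p̃ of an autonomous MOD system with a rebalancing policy is again a routing matrix of the same type as p: for every i one has p̃ i j ≥ 0, p̃ i i = 0 and ∑ j, p̃ i j = 1; moreover p̃ is irreducible, i.e., for all i, j there exists n ≥ 1 with (p̃ ^ n) i j > 0. -/
open Finset

/-- The combined routing matrix `p̃` of an autonomous MOD system with a
rebalancing policy `(ψ, α)` is again a routing matrix of the same type as `p`: it is
entrywise nonnegative, has zero diagonal, has unit row sums, and is irreducible. -/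
theorem combined_routing_matrix_is_routing_matrix
    (N : ℕ) (hN : 2 ≤ N)
    (p : Matrix (Fin N) (Fin N) ℝ)
    (hp_nonneg : ∀ i j, 0 ≤ p i j)
    (hp_diag : ∀ i, p i i = 0)
    (hp_row : ∀ i, ∑ j, p i j = 1)
    (hp_irred : ∀ i j, ∃ n, 1 ≤ n ∧ 0 < (p ^ n) i j)
    (lam : Fin N → ℝ) (hlam : ∀ i, 0 < lam i)
    (ψ : Fin N → ℝ) (hψ : ∀ i, 0 ≤ ψ i)
    (α : Matrix (Fin N) (Fin N) ℝ)
    (hα_nonneg : ∀ i j, 0 ≤ α i j)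
    (hα_diag : ∀ i, α i i = 0)
    (hα_row : ∀ i, ∑ j, α i j = 1)
    (pt : Matrix (Fin N) (Fin N) ℝ)
    (hpt : ∀ i j, pt i j = (α i j * ψ i + p i j * lam i) / (lam i + ψ i)) :
    (∀ i j, 0 ≤ pt i j) ∧ (∀ i, pt i i = 0) ∧ (∀ i, ∑ j, pt i j = 1) ∧
      (∀ i j, ∃ n, 1 ≤ n ∧ 0 < (pt ^ n) i j) := by
  have hd : ∀ i, 0 < lam i + ψ i := fun i => add_pos_of_pos_of_nonneg (hlam i) (hψ i)
  have hnn : ∀ i j, 0 ≤ pt i j := fun i j => by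
    rw [hpt]
    exact div_nonneg (add_nonneg (mul_nonneg (hα_nonneg i j) (hψ i))
      (mul_nonneg (hp_nonneg i j) (hlam i).le)) (hd i).le
  have hpos : ∀ i j, 0 < p i j → 0 < pt i j := fun i j h => by
    rw [hpt]
    exact div_pos (add_pos_of_nonneg_of_pos (mul_nonneg (hα_nonneg i j) (hψ i))
      (mul_pos h (hlam i))) (hd i)
  have key : ∀ n i j, 0 ≤ (pt ^ n) i j ∧ (0 < (p ^ n) i j → 0 < (pt ^ n) i j) := by
    intro n
    induction n with
    | zero =>
      intro i j
      simp only [pow_zero, imp_self, and_true]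
      rw [Matrix.one_apply]
      split_ifs <;> norm_num
    | succ n ih =>
      intro i j
      have hterm : ∀ k ∈ Finset.univ, 0 ≤ (pt ^ n) i k * pt k j :=
        fun k _ => mul_nonneg (ih i k).1 (hnn k j)
      rw [pow_succ, pow_succ, Matrix.mul_apply, Matrix.mul_apply]
      refine ⟨Finset.sum_nonneg hterm, fun h => ?_⟩
      obtain ⟨k, hk, hkpos⟩ : ∃ k ∈ Finset.univ, 0 < (p ^ n) i k * p k j := by
        by_contra! hcon
        exact absurd h (not_lt.mpr (Finset.sum_nonpos hcon))
      have h1 : 0 < (p ^ n) i k := pos_of_mul_pos_left hkpos (hp_nonneg k j)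
      have h2 : 0 < p k j := pos_of_mul_pos_right hkpos h1.le
      exact Finset.sum_pos' hterm ⟨k, hk, mul_pos ((ih i k).2 h1) (hpos k j h2)⟩
  refine ⟨hnn, fun i => ?_, fun i => ?_, fun i j => ?_⟩
  · rw [hpt, hα_diag, hp_diag]; simp
  · simp_rw [hpt]
    rw [← Finset.sum_div, Finset.sum_add_distrib, ← Finset.sum_mul, ← Finset.sum_mul,
      hα_row, hp_row, one_mul, one_mul, add_comm]
    exact div_self (hd i).ne'
  · obtain ⟨n, hn, h⟩ := hp_irred i j
    exact ⟨n, hn, (key n i j).2 h⟩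
end

section
/- (Folding of the traffic equations, forward direction.) If π : V → ℝ satisfies the traffic equations of the full network, π v = ∑ u, π u * r u v for every node v, then its station components satisfy the reduced traffic equations π (inl i) = ∑ k, π (inl k) * p̃ k i for every station i, and its road components are determined by π (inr (k, l)) = π (inl k) * p̃ k l for every road node (k, l) with k ≠ l. -/
open Finset Sum

/-- folding of the traffic equations, forward direction. If `π` solves the
traffic equations of the full abstract queueing network, then its station components solve
the reduced traffic equations and its road components are determined by
`π (inr (k, l)) = π (inl k) * p̃ k l`. -/
theorem folding_of_traffic_equations_forward
    (N : ℕ) (hN : 2 ≤ N)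
    (p : Matrix (Fin N) (Fin N) ℝ)
    (hp_nonneg : ∀ i j, 0 ≤ p i j)
    (hp_diag : ∀ i, p i i = 0)
    (hp_row : ∀ i, ∑ j, p i j = 1)
    (hp_irred : ∀ i j, ∃ n, 1 ≤ n ∧ 0 < (p ^ n) i j)
    (lam : Fin N → ℝ) (hlam : ∀ i, 0 < lam i)
    (ψ : Fin N → ℝ) (hψ : ∀ i, 0 ≤ ψ i)
    (α : Matrix (Fin N) (Fin N) ℝ)
    (hα_nonneg : ∀ i j, 0 ≤ α i j)
    (hα_diag : ∀ i, α i i = 0)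
    (hα_row : ∀ i, ∑ j, α i j = 1)
    (pt : Matrix (Fin N) (Fin N) ℝ)
    (hpt : ∀ i j, pt i j = (α i j * ψ i + p i j * lam i) / (lam i + ψ i))
    (r : Matrix (Fin N ⊕ {q : Fin N × Fin N // q.1 ≠ q.2})
                (Fin N ⊕ {q : Fin N × Fin N // q.1 ≠ q.2}) ℝ)
    (hr_SI : ∀ (i : Fin N) (q : {q : Fin N × Fin N // q.1 ≠ q.2}),
      r (inl i) (inr q) = if q.1.1 = i then pt i q.1.2 else 0)
    (hr_IS : ∀ (q : {q : Fin N × Fin N // q.1 ≠ q.2}) (j : Fin N),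
      r (inr q) (inl j) = if j = q.1.2 then 1 else 0)
    (hr_SS : ∀ i j : Fin N, r (inl i) (inl j) = 0)
    (hr_II : ∀ a b : {q : Fin N × Fin N // q.1 ≠ q.2}, r (inr a) (inr b) = 0)
    (π : Fin N ⊕ {q : Fin N × Fin N // q.1 ≠ q.2} → ℝ)
    (hπ : ∀ v, π v = ∑ u, π u * r u v) :
    (∀ i : Fin N, π (inl i) = ∑ k, π (inl k) * pt k i) ∧
      (∀ q : {q : Fin N × Fin N // q.1 ≠ q.2},
        π (inr q) = π (inl q.1.1) * pt q.1.1 q.1.2) := by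
  have hroad : ∀ q : {q : Fin N × Fin N // q.1 ≠ q.2},
      π (inr q) = π (inl q.1.1) * pt q.1.1 q.1.2 := by
    intro q
    rw [hπ (inr q), Fintype.sum_sum_type]
    simp [hr_SI, hr_II]
  refine ⟨fun i => ?_, hroad⟩
  have hdiag : ∀ k, pt k k = 0 := by
    intro k
    simp [hpt, hα_diag, hp_diag]
  rw [hπ (inl i), Fintype.sum_sum_type]
  simp only [hr_SS, hr_IS, hroad, mul_zero, Finset.sum_const_zero, zero_add]
  have key := Fintype.sum_subtype_add_sum_subtype (fun q : Fin N × Fin N => q.1 ≠ q.2)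
    (fun q => π (inl q.1) * pt q.1 q.2 * (if i = q.2 then (1 : ℝ) else 0))
  have hz : ∑ q : {q : Fin N × Fin N // ¬ (q.1 ≠ q.2)},
      π (inl q.1.1) * pt q.1.1 q.1.2 * (if i = q.1.2 then (1 : ℝ) else 0) = 0 := by
    apply Finset.sum_eq_zero
    rintro ⟨⟨a, b⟩, h⟩ _
    have hab : a = b := not_not.mp h
    subst hab
    simp [hdiag]
  rw [hz, add_zero] at key
  refine key.trans ?_
  rw [Fintype.sum_prod_type]
  simp
end

section
/- (Folding of the traffic equations, converse direction.) If a vector π₀ : Fin N → ℝ satisfies the reduced traffic equations π₀ i = ∑ k, π₀ k * p̃ k i for every station i, then the vector π : V → ℝ defined by π (inl i) = π₀ i on station nodes and π (inr (k, l)) = π₀ k * p̃ k l on road nodes satisfies the traffic equations of the full network: π v = ∑ u, π u * r u v for every node v. -/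
open Finset Sum

/-- folding of the traffic equations, converse direction. If `π₀` solves the
reduced traffic equations, then the vector `π` defined on the full abstract queueing network
by `π (inl i) = π₀ i` and `π (inr (k, l)) = π₀ k * p̃ k l` solves the traffic equations of the
full network. -/
theorem folding_of_traffic_equations_converse
    (N : ℕ) (hN : 2 ≤ N)
    (p : Matrix (Fin N) (Fin N) ℝ)
    (hp_nonneg : ∀ i j, 0 ≤ p i j)
    (hp_diag : ∀ i, p i i = 0)
    (hp_row : ∀ i, ∑ j, p i j = 1)
    (hp_irred : ∀ i j, ∃ n, 1 ≤ n ∧ 0 < (p ^ n) i j)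
    (lam : Fin N → ℝ) (hlam : ∀ i, 0 < lam i)
    (ψ : Fin N → ℝ) (hψ : ∀ i, 0 ≤ ψ i)
    (α : Matrix (Fin N) (Fin N) ℝ)
    (hα_nonneg : ∀ i j, 0 ≤ α i j)
    (hα_diag : ∀ i, α i i = 0)
    (hα_row : ∀ i, ∑ j, α i j = 1)
    (pt : Matrix (Fin N) (Fin N) ℝ)
    (hpt : ∀ i j, pt i j = (α i j * ψ i + p i j * lam i) / (lam i + ψ i))
    (r : Matrix (Fin N ⊕ {q : Fin N × Fin N // q.1 ≠ q.2})
                (Fin N ⊕ {q : Fin N × Fin N // q.1 ≠ q.2}) ℝ)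
    (hr_SI : ∀ (i : Fin N) (q : {q : Fin N × Fin N // q.1 ≠ q.2}),
      r (inl i) (inr q) = if q.1.1 = i then pt i q.1.2 else 0)
    (hr_IS : ∀ (q : {q : Fin N × Fin N // q.1 ≠ q.2}) (j : Fin N),
      r (inr q) (inl j) = if j = q.1.2 then 1 else 0)
    (hr_SS : ∀ i j : Fin N, r (inl i) (inl j) = 0)
    (hr_II : ∀ a b : {q : Fin N × Fin N // q.1 ≠ q.2}, r (inr a) (inr b) = 0)
    (π₀ : Fin N → ℝ)
    (hπ₀ : ∀ i, π₀ i = ∑ k, π₀ k * pt k i)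
    (π : Fin N ⊕ {q : Fin N × Fin N // q.1 ≠ q.2} → ℝ)
    (hπS : ∀ i : Fin N, π (inl i) = π₀ i)
    (hπI : ∀ q : {q : Fin N × Fin N // q.1 ≠ q.2}, π (inr q) = π₀ q.1.1 * pt q.1.1 q.1.2) :
    ∀ v, π v = ∑ u, π u * r u v := by
  have hd : ∀ i, pt i i = 0 := by
    intro i
    rw [hpt, hα_diag, hp_diag]
    simp
  intro v
  rw [Fintype.sum_sum_type]
  rcases v with j | q
  · simp only [hr_SS, hr_IS, hπS, hπI, mul_zero, Finset.sum_const_zero, zero_add]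
    have h := Fintype.sum_subtype_add_sum_subtype (fun q : Fin N × Fin N => q.1 ≠ q.2)
      (fun q => π₀ q.1 * pt q.1 q.2 * (if j = q.2 then (1 : ℝ) else 0))
    have h0 : ∑ q : {q : Fin N × Fin N // ¬ (q.1 ≠ q.2)},
        π₀ q.1.1 * pt q.1.1 q.1.2 * (if j = q.1.2 then (1 : ℝ) else 0) = 0 := by
      apply Finset.sum_eq_zero
      rintro ⟨⟨a, b⟩, hq⟩ _
      have hab : a = b := not_not.mp hq
      subst hab
      simp [hd]
    rw [h0, add_zero] at h
    rw [hπ₀ j]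
    refine Eq.trans ?_ h.symm
    rw [Fintype.sum_prod_type]
    simp
  · simp [hr_SI, hr_II, hπS, hπI]
end

section
/- (Balance constraint implies equalized utilizations.) Let (ψ, α) be a rebalancing policy satisfying the balance condition λ i + ψ i = ∑ j, (α j i * ψ j + p j i * λ j) for every i, and let π : Fin N → ℝ be a vector with π i > 0 for all i satisfying the reduced traffic equations π i = ∑ k, π k * p̃ k i for every i. Then the relative utilizations γ i = π i / (λ i + ψ i) are all equal: γ i = γ j for all i, j. -/
open Finset

/-- balance constraint implies equalized utilizations. If a rebalancing
policy satisfies the balance condition `λ i + ψ i = ∑ j, (α j i * ψ j + p j i * λ j)`, then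
every positive solution `π` of the reduced traffic equations has equalized relative
utilizations `γ i = π i / (λ i + ψ i)`. -/
theorem balance_implies_equal_utilizations
    (N : ℕ) (hN : 2 ≤ N)
    (p : Matrix (Fin N) (Fin N) ℝ)
    (hp_nonneg : ∀ i j, 0 ≤ p i j)
    (hp_diag : ∀ i, p i i = 0)
    (hp_row : ∀ i, ∑ j, p i j = 1)
    (hp_irred : ∀ i j, ∃ n, 1 ≤ n ∧ 0 < (p ^ n) i j)
    (lam : Fin N → ℝ) (hlam : ∀ i, 0 < lam i)
    (ψ : Fin N → ℝ) (hψ : ∀ i, 0 ≤ ψ i)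
    (α : Matrix (Fin N) (Fin N) ℝ)
    (hα_nonneg : ∀ i j, 0 ≤ α i j)
    (hα_diag : ∀ i, α i i = 0)
    (hα_row : ∀ i, ∑ j, α i j = 1)
    (pt : Matrix (Fin N) (Fin N) ℝ)
    (hpt : ∀ i j, pt i j = (α i j * ψ i + p i j * lam i) / (lam i + ψ i))
    (hbal : ∀ i, lam i + ψ i = ∑ j, (α j i * ψ j + p j i * lam j))
    (π : Fin N → ℝ)
    (hπ_pos : ∀ i, 0 < π i)
    (hπ : ∀ i, π i = ∑ k, π k * pt k i)
    (γ : Fin N → ℝ)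
    (hγ : ∀ i, γ i = π i / (lam i + ψ i)) :
    ∀ i j, γ i = γ j := by
  have hpos : ∀ i, 0 < lam i + ψ i := fun i => add_pos_of_pos_of_nonneg (hlam i) (hψ i)
  have hN' : Nonempty (Fin N) := ⟨⟨0, by omega⟩⟩
  obtain ⟨m, hm⟩ := Finite.exists_max γ
  have key : ∀ i, ∑ k, (γ i - γ k) * (α k i * ψ k + p k i * lam k) = 0 := by
    intro i
    have h1 : ∑ k, γ k * (α k i * ψ k + p k i * lam k) = π i := by
      rw [hπ i]
      refine Finset.sum_congr rfl fun k _ => ?_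
      rw [hγ, hpt]
      ring
    have h2 : γ i * (lam i + ψ i) = π i := by
      rw [hγ]
      exact div_mul_cancel₀ _ (hpos i).ne'
    simp only [sub_mul, Finset.sum_sub_distrib]
    rw [h1, ← Finset.mul_sum, ← hbal, h2, sub_self]
  have step : ∀ i k, γ i = γ m → p k i ≠ 0 → γ k = γ m := by
    intro i k hi hk
    have hnn : ∀ k ∈ Finset.univ, 0 ≤ (γ i - γ k) * (α k i * ψ k + p k i * lam k) := by
      intro k _
      refine mul_nonneg ?_ (add_nonneg (mul_nonneg (hα_nonneg _ _) (hψ _))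
        (mul_nonneg (hp_nonneg _ _) (hlam _).le))
      have := hm k
      linarith
    have h0 := (Finset.sum_eq_zero_iff_of_nonneg hnn).1 (key i) k (Finset.mem_univ k)
    have hw : 0 < α k i * ψ k + p k i * lam k :=
      add_pos_of_nonneg_of_pos (mul_nonneg (hα_nonneg _ _) (hψ _))
        (mul_pos (lt_of_le_of_ne (hp_nonneg _ _) hk.symm) (hlam _))
    rcases mul_eq_zero.1 h0 with h | h
    · linarith
    · exact absurd h hw.ne'
  have reach : ∀ n k, (p ^ n) k m ≠ 0 → γ k = γ m := by
    intro n
    induction n with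
    | zero =>
      intro k hk
      by_cases h : k = m
      · rw [h]
      · simp [Matrix.one_apply, h] at hk
    | succ n ih =>
      intro k hk
      rw [pow_succ', Matrix.mul_apply] at hk
      obtain ⟨j, _, hj⟩ := Finset.exists_ne_zero_of_sum_ne_zero hk
      exact step j k (ih j (right_ne_zero_of_mul hj)) (left_ne_zero_of_mul hj)
  have all : ∀ k, γ k = γ m := by
    intro k
    obtain ⟨n, _, hn⟩ := hp_irred k m
    exact reach n k hn.ne'
  intro i j
  rw [all i, all j]
end

section
/- (Equalized utilizations imply the balance constraint.) Let (ψ, α) be a rebalancing policy and let π : Fin N → ℝ be a nonzero nonnegative solution of the reduced traffic equations π i = ∑ k, π k * p̃ k i for every i. If the relative utilizations γ i = π i / (λ i + ψ i) satisfy γ i = γ j for all i, j, then the balance condition λ i + ψ i = ∑ j, (α j i * ψ j + p j i * λ j) holds for every i. -/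
open Finset

/-- equalized utilizations imply the balance constraint. If a nonzero
nonnegative solution `π` of the reduced traffic equations has equalized relative utilizations
`γ i = π i / (λ i + ψ i)`, then the rebalancing policy satisfies the balance condition
`λ i + ψ i = ∑ j, (α j i * ψ j + p j i * λ j)` for every `i`. -/
theorem equal_utilizations_imply_balance
    (N : ℕ) (hN : 2 ≤ N)
    (p : Matrix (Fin N) (Fin N) ℝ)
    (hp_nonneg : ∀ i j, 0 ≤ p i j)
    (hp_diag : ∀ i, p i i = 0)
    (hp_row : ∀ i, ∑ j, p i j = 1)
    (hp_irred : ∀ i j, ∃ n, 1 ≤ n ∧ 0 < (p ^ n) i j)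
    (lam : Fin N → ℝ) (hlam : ∀ i, 0 < lam i)
    (ψ : Fin N → ℝ) (hψ : ∀ i, 0 ≤ ψ i)
    (α : Matrix (Fin N) (Fin N) ℝ)
    (hα_nonneg : ∀ i j, 0 ≤ α i j)
    (hα_diag : ∀ i, α i i = 0)
    (hα_row : ∀ i, ∑ j, α i j = 1)
    (pt : Matrix (Fin N) (Fin N) ℝ)
    (hpt : ∀ i j, pt i j = (α i j * ψ i + p i j * lam i) / (lam i + ψ i))
    (π : Fin N → ℝ)
    (hπ_nonneg : ∀ i, 0 ≤ π i)
    (hπ_ne : π ≠ 0)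
    (hπ : ∀ i, π i = ∑ k, π k * pt k i)
    (γ : Fin N → ℝ)
    (hγ : ∀ i, γ i = π i / (lam i + ψ i))
    (heq : ∀ i j, γ i = γ j) :
    ∀ i, lam i + ψ i = ∑ j, (α j i * ψ j + p j i * lam j) := by
  intro i
  have hpos : ∀ k, lam k + ψ k ≠ 0 := fun k =>
    (add_pos_of_pos_of_nonneg (hlam k) (hψ k)).ne'
  have hπγ : ∀ k, π k = γ i * (lam k + ψ k) := fun k => by
    rw [heq i k, hγ k, div_mul_cancel₀ _ (hpos k)]
  have hne : γ i ≠ 0 := by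
    intro h
    apply hπ_ne
    funext k
    rw [hπγ k, h, zero_mul, Pi.zero_apply]
  apply mul_left_cancel₀ hne
  rw [← hπγ i, hπ i, Finset.mul_sum]
  refine Finset.sum_congr rfl fun k _ => ?_
  rw [hπγ k, hpt k i, mul_assoc, mul_div_cancel₀ _ (hpos k)]
end

section
/- (LP solutions yield balanced rebalancing policies with equal cost.) Let β be LP-feasible and define ψ i = ∑ j, β i j, α i i = 0, and for j ≠ i, α i j = β i j / ψ i if ψ i > 0 and α i j = 1 / (N − 1) if ψ i = 0. Then (ψ, α) is a rebalancing policy (ψ i ≥ 0, α i j ≥ 0, α i i = 0, ∑ j, α i j = 1), it satisfies the balance condition λ i + ψ i = ∑ j, (α j i * ψ j + p j i * λ j) for every i, and its cost equals that of β: ∑ i, ∑ j, T i j * α i j * ψ i = ∑ i, ∑ j, T i j * β i j. -/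
open Finset

/-- LP solutions yield balanced rebalancing policies with equal cost. From an
LP-feasible flow `β`, setting `ψ i = ∑ j, β i j` and `α i j = β i j / ψ i` (uniform when
`ψ i = 0`, zero on the diagonal) produces a genuine rebalancing policy that satisfies the
balance condition and whose cost equals that of `β`. -/
theorem LP_solution_gives_balanced_policy
    (N : ℕ) (hN : 2 ≤ N)
    (p : Matrix (Fin N) (Fin N) ℝ)
    (hp_nonneg : ∀ i j, 0 ≤ p i j)
    (hp_diag : ∀ i, p i i = 0)
    (hp_row : ∀ i, ∑ j, p i j = 1)
    (hp_irred : ∀ i j, ∃ n, 1 ≤ n ∧ 0 < (p ^ n) i j)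
    (lam : Fin N → ℝ) (hlam : ∀ i, 0 < lam i)
    (T : Matrix (Fin N) (Fin N) ℝ)
    (hT_pos : ∀ i j, i ≠ j → 0 < T i j)
    (hT_diag : ∀ i, T i i = 0)
    (β : Matrix (Fin N) (Fin N) ℝ)
    (hβ_nonneg : ∀ i j, 0 ≤ β i j)
    (hβ_diag : ∀ i, β i i = 0)
    (hβ_flow : ∀ i, ∑ j, (β i j - β j i) = -lam i + ∑ j, p j i * lam j)
    (ψ : Fin N → ℝ)
    (hψdef : ∀ i, ψ i = ∑ j, β i j)
    (α : Matrix (Fin N) (Fin N) ℝ)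
    (hα_diag : ∀ i, α i i = 0)
    (hα_off : ∀ i j, j ≠ i →
      α i j = if 0 < ψ i then β i j / ψ i else 1 / ((N : ℝ) - 1)) :
    (∀ i, 0 ≤ ψ i) ∧ (∀ i j, 0 ≤ α i j) ∧ (∀ i, α i i = 0) ∧ (∀ i, ∑ j, α i j = 1) ∧
      (∀ i, lam i + ψ i = ∑ j, (α j i * ψ j + p j i * lam j)) ∧
      (∑ i, ∑ j, T i j * α i j * ψ i = ∑ i, ∑ j, T i j * β i j) := by
  have hψ0 : ∀ i, 0 ≤ ψ i := fun i => by
    rw [hψdef]; exact Finset.sum_nonneg fun j _ => hβ_nonneg i j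
  have hN1 : (0 : ℝ) < (N : ℝ) - 1 := by
    have : (2 : ℝ) ≤ N := by exact_mod_cast hN
    linarith
  have key : ∀ i j, α i j * ψ i = β i j := by
    intro i j
    by_cases hij : j = i
    · subst hij; rw [hα_diag, hβ_diag, zero_mul]
    · rw [hα_off i j hij]
      split_ifs with h
      · exact div_mul_cancel₀ _ h.ne'
      · have h0 : ψ i = 0 := le_antisymm (not_lt.mp h) (hψ0 i)
        have h1 : ∑ j, β i j = 0 := by rw [← hψdef, h0]
        have h2 := (Finset.sum_eq_zero_iff_of_nonneg (fun j _ => hβ_nonneg i j)).mp h1 j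
          (Finset.mem_univ j)
        rw [h0, h2, mul_zero]
  refine ⟨hψ0, ?_, hα_diag, ?_, ?_, ?_⟩
  · intro i j
    by_cases hij : j = i
    · subst hij; rw [hα_diag]
    · rw [hα_off i j hij]
      split_ifs with h
      · exact div_nonneg (hβ_nonneg i j) h.le
      · exact div_nonneg zero_le_one hN1.le
  · intro i
    by_cases h : 0 < ψ i
    · have h1 : (∑ j, α i j) * ψ i = 1 * ψ i := by
        rw [Finset.sum_mul, one_mul, hψdef i, ← hψdef i]
        simp only [key]
        exact (hψdef i).symm
      exact mul_right_cancel₀ h.ne' h1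
    · rw [← Finset.add_sum_erase _ _ (Finset.mem_univ i), hα_diag, zero_add]
      have h1 : ∀ j ∈ Finset.univ.erase i, α i j = 1 / ((N : ℝ) - 1) := fun j hj => by
        rw [hα_off i j (Finset.ne_of_mem_erase hj), if_neg h]
      rw [Finset.sum_congr rfl h1, Finset.sum_const, Finset.card_erase_of_mem (Finset.mem_univ i),
        Finset.card_univ, Fintype.card_fin, nsmul_eq_mul, Nat.cast_sub (by omega), Nat.cast_one]
      exact mul_one_div_cancel hN1.ne'
  · intro i
    have h := hβ_flow i
    rw [Finset.sum_sub_distrib, ← hψdef] at h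
    simp only [key, Finset.sum_add_distrib]
    linarith
  · simp only [mul_assoc, key]
end

section
/- (Theorem 1: solution of the Optimal Rebalancing Problem via a linear program.) Suppose β* is LP-feasible and minimizes the cost ∑ i, ∑ j, T i j * β i j among all LP-feasible β. Define ψ i = ∑ j, β* i j, α i i = 0, and for j ≠ i, α i j = β* i j / ψ i if ψ i > 0 and α i j = 1 / (N − 1) if ψ i = 0. Then (ψ, α) is ORP-feasible, and it is optimal for the ORP: for every ORP-feasible rebalancing policy (ψ', α'), ∑ i, ∑ j, T i j * α i j * ψ i ≤ ∑ i, ∑ j, T i j * α' i j * ψ' i. -/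
open Finset

/-- A rebalancing policy `(ψ, α)` is ORP-feasible if every strictly positive solution `π` of
the reduced traffic equations (for the combined routing matrix
`p̃ k i = (α k i * ψ k + p k i * λ k) / (λ k + ψ k)`) has equalized relative utilizations
`π i / (λ i + ψ i)`. -/
def ORPFeasible {N : ℕ} (p : Matrix (Fin N) (Fin N) ℝ) (lam : Fin N → ℝ)
    (ψ : Fin N → ℝ) (α : Matrix (Fin N) (Fin N) ℝ) : Prop :=
  ∀ π : Fin N → ℝ, (∀ i, 0 < π i) →
    (∀ i, π i = ∑ k, π k * ((α k i * ψ k + p k i * lam k) / (lam k + ψ k))) →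
    ∀ i j, π i / (lam i + ψ i) = π j / (lam j + ψ j)

theorem aux_propagate {N : ℕ} (p : Matrix (Fin N) (Fin N) ℝ)
    (hp_irred : ∀ i j, ∃ n, 1 ≤ n ∧ 0 < (p ^ n) i j)
    (S : Fin N → Prop) (hS : ∀ i j, p i j ≠ 0 → S i → S j) (i : Fin N) (hi : S i) (j : Fin N) :
    S j := by
  have key : ∀ n : ℕ, ∀ j, (p ^ n) i j ≠ 0 → S j := by
    intro n
    induction n with
    | zero =>
      intro j hj
      by_cases h : i = j
      · exact h ▸ hi
      · exact absurd (by simp [h]) hj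
    | succ n ih =>
      intro j hj
      rw [pow_succ, Matrix.mul_apply] at hj
      obtain ⟨k, -, hk⟩ := Finset.exists_ne_zero_of_sum_ne_zero hj
      exact hS k j (right_ne_zero_of_mul hk) (ih k (left_ne_zero_of_mul hk))
  obtain ⟨n, -, h⟩ := hp_irred i j
  exact key n j h.ne'

theorem aux_const {N : ℕ} (p : Matrix (Fin N) (Fin N) ℝ)
    (hp_irred : ∀ i j, ∃ n, 1 ≤ n ∧ 0 < (p ^ n) i j)
    (M : Matrix (Fin N) (Fin N) ℝ) (hM : ∀ i j, 0 ≤ M i j) (hMp : ∀ i j, p i j ≠ 0 → 0 < M i j)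
    (x : Fin N → ℝ) (hx : ∀ i, (∑ k, M k i) * x i = ∑ k, M k i * x k) (i j : Fin N) :
    x i = x j := by
  obtain ⟨m, -, hm⟩ := Finset.exists_max_image Finset.univ x ⟨i, Finset.mem_univ i⟩
  have hall : ∀ k, x k = x m := by
    intro k
    by_contra hk
    refine aux_propagate p hp_irred (fun k => x k ≠ x m) ?_ k hk m rfl
    intro a b hab ha hb
    have h0 : ∑ k, M k b * (x m - x k) = 0 := by
      have := hx b
      rw [hb, Finset.sum_mul] at this
      simp only [mul_sub, Finset.sum_sub_distrib]
      linarith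
    have h1 := (Finset.sum_eq_zero_iff_of_nonneg (fun k _ =>
      mul_nonneg (hM k b) (sub_nonneg.2 (hm k (Finset.mem_univ k))))).1 h0 a (Finset.mem_univ a)
    rcases mul_eq_zero.1 h1 with h | h
    · exact (hMp a b hab).ne' h
    · exact ha (by linarith)
  rw [hall i, hall j]

theorem aux_exists {N : ℕ} (hN : 2 ≤ N) (p : Matrix (Fin N) (Fin N) ℝ)
    (hp_irred : ∀ i j, ∃ n, 1 ≤ n ∧ 0 < (p ^ n) i j)
    (P : Matrix (Fin N) (Fin N) ℝ) (hP : ∀ i j, 0 ≤ P i j) (hPp : ∀ i j, p i j ≠ 0 → 0 < P i j)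
    (hrow : ∀ i, ∑ j, P i j = 1) :
    ∃ w : Fin N → ℝ, (∀ i, 0 < w i) ∧ ∀ i, w i = ∑ k, w k * P k i := by
  have hdet : (P - 1).det = 0 := by
    apply Matrix.exists_mulVec_eq_zero_iff.1
    refine ⟨fun _ => 1, ?_, ?_⟩
    · intro h
      exact one_ne_zero (congrFun h ⟨0, by omega⟩)
    · rw [Matrix.sub_mulVec, Matrix.one_mulVec]
      funext i
      simp [Matrix.mulVec, dotProduct, hrow]
  obtain ⟨v, hv0, hv⟩ := Matrix.exists_vecMul_eq_zero_iff.2 hdet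
  have hv' : ∀ i, v i = ∑ k, v k * P k i := by
    intro i
    have := congrFun hv i
    rw [Matrix.vecMul_sub, Matrix.vecMul_one] at this
    simp only [Pi.sub_apply, Matrix.vecMul, dotProduct, Pi.zero_apply] at this
    linarith
  have hle : ∀ i, |v i| ≤ ∑ k, |v k| * P k i := by
    intro i
    calc |v i| = |∑ k, v k * P k i| := by rw [← hv' i]
      _ ≤ ∑ k, |v k * P k i| := Finset.abs_sum_le_sum_abs _ _
      _ = _ := by
        refine Finset.sum_congr rfl fun k _ => ?_
        rw [abs_mul, abs_of_nonneg (hP k i)]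
  have hsum : ∑ i, |v i| = ∑ i, ∑ k, |v k| * P k i := by
    rw [Finset.sum_comm]
    simp [← Finset.mul_sum, hrow]
  have heq := (Finset.sum_eq_sum_iff_of_le (fun i _ => hle i)).1 hsum
  refine ⟨fun i => |v i|, ?_, fun i => heq i (Finset.mem_univ i)⟩
  obtain ⟨i0, hi0⟩ := Function.ne_iff.1 hv0
  intro j
  refine aux_propagate p hp_irred (fun k => 0 < |v k|) ?_ i0 (abs_pos.2 hi0) j
  intro a b hab ha
  rw [heq b (Finset.mem_univ b)]
  exact lt_of_lt_of_le (mul_pos ha (hPp a b hab))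
    (Finset.single_le_sum (f := fun k => |v k| * P k b)
      (fun k _ => mul_nonneg (abs_nonneg _) (hP k b)) (Finset.mem_univ a))

/-- Theorem 1: solution of the Optimal Rebalancing Problem via a linear
program. If `β*` is an optimal solution of the rebalancing LP, then the rebalancing policy
obtained by setting `ψ i = ∑ j, β* i j` and `α i j = β* i j / ψ i` (uniform when `ψ i = 0`,
zero on the diagonal) is ORP-feasible and optimal for the ORP. -/
theorem optimal_rebalancing_via_LP
    (N : ℕ) (hN : 2 ≤ N)
    (p : Matrix (Fin N) (Fin N) ℝ)
    (hp_nonneg : ∀ i j, 0 ≤ p i j)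
    (hp_diag : ∀ i, p i i = 0)
    (hp_row : ∀ i, ∑ j, p i j = 1)
    (hp_irred : ∀ i j, ∃ n, 1 ≤ n ∧ 0 < (p ^ n) i j)
    (lam : Fin N → ℝ) (hlam : ∀ i, 0 < lam i)
    (T : Matrix (Fin N) (Fin N) ℝ)
    (hT_pos : ∀ i j, i ≠ j → 0 < T i j)
    (hT_diag : ∀ i, T i i = 0)
    (βs : Matrix (Fin N) (Fin N) ℝ)
    (hβ_nonneg : ∀ i j, 0 ≤ βs i j)
    (hβ_diag : ∀ i, βs i i = 0)
    (hβ_flow : ∀ i, ∑ j, (βs i j - βs j i) = -lam i + ∑ j, p j i * lam j)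
    (hβ_opt : ∀ β : Matrix (Fin N) (Fin N) ℝ,
      (∀ i j, 0 ≤ β i j) → (∀ i, β i i = 0) →
      (∀ i, ∑ j, (β i j - β j i) = -lam i + ∑ j, p j i * lam j) →
      ∑ i, ∑ j, T i j * βs i j ≤ ∑ i, ∑ j, T i j * β i j)
    (ψ : Fin N → ℝ)
    (hψdef : ∀ i, ψ i = ∑ j, βs i j)
    (α : Matrix (Fin N) (Fin N) ℝ)
    (hα_diag : ∀ i, α i i = 0)
    (hα_off : ∀ i j, j ≠ i →
      α i j = if 0 < ψ i then βs i j / ψ i else 1 / ((N : ℝ) - 1)) :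
    ORPFeasible p lam ψ α ∧
      (∀ (ψ' : Fin N → ℝ) (α' : Matrix (Fin N) (Fin N) ℝ),
        (∀ i, 0 ≤ ψ' i) → (∀ i j, 0 ≤ α' i j) → (∀ i, α' i i = 0) →
        (∀ i, ∑ j, α' i j = 1) →
        ORPFeasible p lam ψ' α' →
        ∑ i, ∑ j, T i j * α i j * ψ i ≤ ∑ i, ∑ j, T i j * α' i j * ψ' i) := by
  have hψ : ∀ i, 0 ≤ ψ i := fun i => by
    rw [hψdef]; exact Finset.sum_nonneg fun j _ => hβ_nonneg i j
  have hαβ : ∀ i j, α i j * ψ i = βs i j := by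
    intro i j
    by_cases hij : j = i
    · subst hij; rw [hα_diag, hβ_diag, zero_mul]
    rw [hα_off i j hij]
    split_ifs with h
    · field_simp
    · have h0 : ψ i = 0 := le_antisymm (not_lt.1 h) (hψ i)
      rw [h0, mul_zero]
      rw [hψdef] at h0
      exact ((Finset.sum_eq_zero_iff_of_nonneg (fun j _ => hβ_nonneg i j)).1 h0 j
        (Finset.mem_univ j)).symm
  have hpl : ∀ i j, p i j ≠ 0 → 0 < p i j * lam i := fun i j h =>
    mul_pos (lt_of_le_of_ne (hp_nonneg i j) h.symm) (hlam i)
  constructor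
  · intro π hπ htr i j
    refine aux_const p hp_irred (fun k i => βs k i + p k i * lam k) ?_ ?_
      (fun i => π i / (lam i + ψ i)) ?_ i j
    · intro i j
      exact add_nonneg (hβ_nonneg i j) (mul_nonneg (hp_nonneg i j) (hlam i).le)
    · intro i j h
      exact add_pos_of_nonneg_of_pos (hβ_nonneg i j) (hpl i j h)
    · intro i
      have hcol : ∑ k, (βs k i + p k i * lam k) = lam i + ψ i := by
        have := hβ_flow i
        rw [Finset.sum_sub_distrib, ← hψdef] at this
        rw [Finset.sum_add_distrib]
        linarith
      have hd : lam i + ψ i ≠ 0 := (add_pos_of_pos_of_nonneg (hlam i) (hψ i)).ne'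
      simp only [hcol]
      rw [mul_div_cancel₀ _ hd, htr i]
      refine Finset.sum_congr rfl fun k _ => ?_
      rw [hαβ]
      ring
  · intro ψ' α' hψ' hα' hαd' hαr' hfeas
    have hd : ∀ i, 0 < lam i + ψ' i := fun i => add_pos_of_pos_of_nonneg (hlam i) (hψ' i)
    obtain ⟨w, hw, hwt⟩ := aux_exists hN p hp_irred
      (fun k i => (α' k i * ψ' k + p k i * lam k) / (lam k + ψ' k))
      (fun i j => div_nonneg (add_nonneg (mul_nonneg (hα' i j) (hψ' i))
        (mul_nonneg (hp_nonneg i j) (hlam i).le)) (hd i).le)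
      (fun i j h => div_pos (add_pos_of_nonneg_of_pos (mul_nonneg (hα' i j) (hψ' i))
        (hpl i j h)) (hd i))
      (fun i => by
        rw [← Finset.sum_div, Finset.sum_add_distrib, ← Finset.sum_mul, ← Finset.sum_mul,
          hαr', hp_row, one_mul, one_mul, add_comm, div_self (hd i).ne'])
    have hEq := hfeas w hw hwt
    have hopt := hβ_opt (fun i j => α' i j * ψ' i) (fun i j => mul_nonneg (hα' i j) (hψ' i))
      (fun i => by simp [hαd']) (by
        intro i
        have hc : 0 < w i / (lam i + ψ' i) := div_pos (hw i) (hd i)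
        have h1 : (w i / (lam i + ψ' i)) * (lam i + ψ' i)
            = (w i / (lam i + ψ' i)) * ∑ k, (α' k i * ψ' k + p k i * lam k) := by
          rw [div_mul_cancel₀ _ (hd i).ne', Finset.mul_sum]
          conv_lhs => rw [hwt i]
          refine Finset.sum_congr rfl fun k _ => ?_
          rw [hEq i k]
          ring
        have h2 := mul_left_cancel₀ hc.ne' h1
        rw [Finset.sum_add_distrib] at h2
        rw [Finset.sum_sub_distrib, ← Finset.sum_mul, hαr']
        linarith)
    simpa only [mul_assoc, hαβ] using hopt
end

section
/- (Availability bound without rebalancing.) For every m ≥ 1, G m ≥ γmax * G (m − 1); consequently G m > 0 and, for every single-server node i, the availability A i m = γ i * G (m − 1) / G m satisfies A i m ≤ γ i / γmax. In particular, if γ i < γmax then A i m < 1 for every m ≥ 1. -/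
open Finset

/-- The normalization constant `G m` of a closed Jackson network with `m` vehicles, station
(single-server) nodes `S` with relative utilizations `γ` and road (infinite-server) nodes `I`
with relative utilizations `ρ`: the sum over all occupancy vectors `x : S ⊕ I → ℕ` with total
`m` of `(∏ i, γ i ^ x (inl i)) * ∏ r, ρ r ^ x (inr r) / (x (inr r))!`. -/
noncomputable def jacksonG (S I : Type*) [Fintype S] [Fintype I]
    [DecidableEq S] [DecidableEq I] (γ : S → ℝ) (ρ : I → ℝ) (m : ℕ) : ℝ :=
  ∑ x ∈ (Fintype.piFinset fun _ : S ⊕ I => Finset.range (m + 1)).filter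
      (fun x => ∑ v, x v = m),
    (∏ i, γ i ^ x (Sum.inl i)) *
      ∏ r, ρ r ^ x (Sum.inr r) / (Nat.factorial (x (Sum.inr r)))

lemma jackson_step (S I : Type*) [Fintype S] [Fintype I]
    [DecidableEq S] [DecidableEq I]
    (γ : S → ℝ) (hγ : ∀ i, 0 < γ i)
    (ρ : I → ℝ) (hρ : ∀ r, 0 < ρ r) (j : S) (n : ℕ) :
    γ j * jacksonG S I γ ρ n ≤ jacksonG S I γ ρ (n + 1) := by
  unfold jacksonG
  rw [Finset.mul_sum]
  have hinj : Function.Injective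
      (fun x : S ⊕ I → ℕ => x + Pi.single (Sum.inl j) 1) := add_left_injective _
  calc _ = ∑ x ∈ ((Fintype.piFinset fun _ : S ⊕ I => Finset.range (n + 1)).filter
          (fun x => ∑ v, x v = n)).image
            (fun x : S ⊕ I → ℕ => x + Pi.single (Sum.inl j) 1),
          (∏ i, γ i ^ x (Sum.inl i)) *
            ∏ r, ρ r ^ x (Sum.inr r) / (Nat.factorial (x (Sum.inr r)) : ℝ) := by
        rw [Finset.sum_image (fun _ _ _ _ h => hinj h)]
        refine Finset.sum_congr rfl fun x _ => ?_
        have h1 : ∏ i, γ i ^ ((x + Pi.single (Sum.inl j) 1 : S ⊕ I → ℕ) (Sum.inl i))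
            = γ j * ∏ i, γ i ^ x (Sum.inl i) := by
          simp only [Pi.add_apply, pow_add, Finset.prod_mul_distrib]
          rw [mul_comm]
          congr 1
          rw [Finset.prod_eq_single j]
          · simp
          · intro b _ hb
            simp [hb]
          · simp
        rw [h1]
        simp [mul_assoc]
    _ ≤ _ := by
        refine Finset.sum_le_sum_of_subset_of_nonneg ?_ ?_
        · intro y hy
          simp only [Finset.mem_image, Finset.mem_filter, Fintype.mem_piFinset,
            Finset.mem_range] at hy ⊢
          obtain ⟨x, ⟨hx, hs⟩, rfl⟩ := hy
          refine ⟨fun v => ?_, ?_⟩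
          · have := hx v
            have h2 : (Pi.single (Sum.inl j) 1 : S ⊕ I → ℕ) v ≤ 1 := by
              rw [Pi.single_apply]; split_ifs <;> simp
            simp only [Pi.add_apply]
            omega
          · simp only [Pi.add_apply, Finset.sum_add_distrib, hs]
            simp
        · intro x _ _
          exact mul_nonneg (Finset.prod_nonneg fun i _ => pow_nonneg (hγ i).le _)
            (Finset.prod_nonneg fun r _ => div_nonneg (pow_nonneg (hρ r).le _) (by positivity))

lemma jackson_pos (S I : Type*) [Fintype S] [Nonempty S] [Fintype I]
    [DecidableEq S] [DecidableEq I]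
    (γ : S → ℝ) (hγ : ∀ i, 0 < γ i)
    (ρ : I → ℝ) (hρ : ∀ r, 0 < ρ r) (n : ℕ) : 0 < jacksonG S I γ ρ n := by
  induction n with
  | zero =>
    unfold jacksonG
    refine Finset.sum_pos (fun x _ => ?_) ⟨0, by simp; rfl⟩
    exact mul_pos (Finset.prod_pos fun i _ => pow_pos (hγ i) _)
      (Finset.prod_pos fun r _ => div_pos (pow_pos (hρ r) _) (by positivity))
  | succ n ih =>
    obtain ⟨j⟩ := ‹Nonempty S›
    exact lt_of_lt_of_le (mul_pos (hγ j) ih) (jackson_step S I γ hγ ρ hρ j n)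

/-- availability bound without rebalancing. For every `m ≥ 1` one has
`G m ≥ γmax * G (m-1)`, hence `G m > 0` and the availability
`A i m = γ i * G (m-1) / G m` satisfies `A i m ≤ γ i / γmax`; in particular stations with
`γ i < γmax` have availability strictly less than `1`. -/
theorem availability_bound_without_rebalancing
    (S I : Type*) [Fintype S] [Nonempty S] [Fintype I]
    [DecidableEq S] [DecidableEq I]
    (γ : S → ℝ) (hγ : ∀ i, 0 < γ i)
    (ρ : I → ℝ) (hρ : ∀ r, 0 < ρ r)
    (γmax : ℝ) (hmax_le : ∀ i, γ i ≤ γmax) (hmax_attained : ∃ i, γ i = γmax)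
    (m : ℕ) (hm : 1 ≤ m) :
    γmax * jacksonG S I γ ρ (m - 1) ≤ jacksonG S I γ ρ m ∧
      0 < jacksonG S I γ ρ m ∧
      (∀ i, γ i * jacksonG S I γ ρ (m - 1) / jacksonG S I γ ρ m ≤ γ i / γmax) ∧
      (∀ i, γ i < γmax →
        γ i * jacksonG S I γ ρ (m - 1) / jacksonG S I γ ρ m < 1) := by
  obtain ⟨j, rfl⟩ := hmax_attained
  obtain ⟨n, rfl⟩ : ∃ n, m = n + 1 := ⟨m - 1, by omega⟩
  rw [Nat.add_sub_cancel]
  have h1 := jackson_step S I γ hγ ρ hρ j n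
  have h0 := jackson_pos S I γ hγ ρ hρ n
  have h2 := jackson_pos S I γ hγ ρ hρ (n + 1)
  have h3 : ∀ i, γ i * jacksonG S I γ ρ n / jacksonG S I γ ρ (n + 1) ≤ γ i / γ j := by
    intro i
    rw [div_le_div_iff₀ h2 (hγ j)]
    nlinarith [mul_le_mul_of_nonneg_left h1 (hγ i).le]
  exact ⟨h1, h2, h3, fun i hi => (h3 i).trans_lt ((div_lt_one (hγ j)).2 hi)⟩
end

section
/- (Limiting availability without rebalancing.) As m → ∞, the ratio G (m − 1) / G m tends to 1 / γmax; consequently, for every single-server node i, the availability A i m = γ i * G (m − 1) / G m tends to γ i / γmax as m → ∞. -/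
open Finset Filter

open Asymptotics in
lemma jk_toeplitz (M : ℝ) (f h g : ℕ → ℝ) (hf : ∀ m, 0 ≤ f m) (hh : ∀ m, 0 ≤ h m)
    (hg : ∀ m, g m = ∑ k ∈ range (m + 1), f k * h (m - k))
    (hfo : (fun m => f (m + 1) - M * f m) =o[atTop] f)
    (h1 : ∀ j, (fun m => h (m - j)) =o[atTop] g)
    (h2 : (fun m => h (m + 1)) =o[atTop] g) :
    (fun m => g (m + 1) - M * g m) =o[atTop] g := by
  have hg0 : ∀ m, 0 ≤ g m := fun m => by
    rw [hg]; exact sum_nonneg fun k _ => mul_nonneg (hf _) (hh _)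
  set d : ℕ → ℝ := fun m => f (m + 1) - M * f m with hd
  have key : (fun m => g (m + 1) - M * g m) =
      fun m => f 0 * h (m + 1) + ∑ k ∈ range (m + 1), d k * h (m - k) := by
    funext m
    rw [hg (m + 1), hg m, sum_range_succ', mul_sum]
    simp only [hd, sub_mul, sum_sub_distrib, Nat.add_sub_add_right, Nat.sub_zero, mul_assoc]
    ring
  rw [key]
  refine (h2.const_mul_left _).add ?_
  rw [isLittleO_iff]
  intro ε hε
  have hN := (isLittleO_iff.1 hfo) (half_pos hε)
  obtain ⟨N, hN⟩ := eventually_atTop.1 hN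
  have h3 : (fun m => ∑ k ∈ range N, |d k| * h (m - k)) =o[atTop] g :=
    IsLittleO.fun_sum fun k _ => (h1 k).const_mul_left _
  filter_upwards [(isLittleO_iff.1 h3) (half_pos hε), eventually_ge_atTop N] with m hm hmN
  have hb : ∀ k, |d k| ≤ ε / 2 * f k + (if k < N then |d k| else 0) := by
    intro k
    split_ifs with hk
    · have := mul_nonneg (half_pos hε).le (hf k); linarith
    · have := hN k (not_lt.1 hk)
      rw [Real.norm_eq_abs, Real.norm_eq_abs, abs_of_nonneg (hf k)] at this
      linarith
  have e1 : ∑ k ∈ range (m + 1), (if k < N then |d k| else 0) * h (m - k)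
      = ∑ k ∈ range N, |d k| * h (m - k) := by
    simp only [ite_mul, zero_mul]
    rw [← sum_filter]
    congr 1
    ext k; simp; omega
  have e2 : ‖∑ k ∈ range (m + 1), d k * h (m - k)‖ ≤
      ε / 2 * g m + ∑ k ∈ range N, |d k| * h (m - k) := by
    refine (norm_sum_le _ _).trans ?_
    rw [← e1, hg m, mul_sum, ← sum_add_distrib]
    refine sum_le_sum fun k _ => ?_
    rw [norm_mul, Real.norm_eq_abs, Real.norm_eq_abs, abs_of_nonneg (hh (m - k)), ← mul_assoc,
      ← add_mul]
    exact mul_le_mul_of_nonneg_right (hb k) (hh _)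
  rw [Real.norm_eq_abs, Real.norm_eq_abs, abs_of_nonneg (hg0 m)] at hm
  rw [Real.norm_eq_abs (g m), abs_of_nonneg (hg0 m)]
  have := le_abs_self (∑ k ∈ range N, |d k| * h (m - k))
  linarith

/-- The invariant kept along the product. -/
def JkGood (M : ℝ) (f : ℕ → ℝ) : Prop :=
  (∃ c, 0 < c ∧ ∀ m, c * M ^ m ≤ f m) ∧
    (fun m => f (m + 1) - M * f m) =o[atTop] f

lemma jk_good_lower (M : ℝ) (hM : 0 < M) (f h g : ℕ → ℝ) (hf : JkGood M f)
    (hh : ∀ m, 0 ≤ h m) (h0 : h 0 = 1)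
    (hg : ∀ m, g m = ∑ k ∈ range (m + 1), f k * h (m - k)) :
    ∃ c, 0 < c ∧ ∀ m, c * M ^ m ≤ g m := by
  obtain ⟨⟨c, hc, hcf⟩, -⟩ := hf
  have hf0 : ∀ m, 0 ≤ f m := fun m => le_trans (by positivity) (hcf m)
  refine ⟨c, hc, fun m => (hcf m).trans ?_⟩
  rw [hg, sum_range_succ, Nat.sub_self, h0, mul_one]
  have : 0 ≤ ∑ k ∈ range m, f k * h (m - k) := sum_nonneg fun k _ => mul_nonneg (hf0 _) (hh _)
  linarith

lemma jk_good_geom (M : ℝ) (hM : 0 < M) (a : ℝ) (ha : 0 < a) (haM : a ≤ M) (f g : ℕ → ℝ)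
    (hf : JkGood M f)
    (hg : ∀ m, g m = ∑ k ∈ range (m + 1), f k * a ^ (m - k)) : JkGood M g := by
  refine ⟨jk_good_lower M hM f (fun k => a ^ k) g hf (fun m => by positivity) (by simp) hg, ?_⟩
  obtain ⟨⟨c, hc, hcf⟩, hfo⟩ := hf
  have hf0 : ∀ m, 0 ≤ f m := fun m => le_trans (by positivity) (hcf m)
  have lower : ∀ m : ℕ, c * (m + 1) * a ^ m ≤ g m := by
    intro m
    rw [hg]
    have : ∑ k ∈ range (m + 1), c * a ^ m = c * (m + 1) * a ^ m := by
      rw [sum_const, card_range, nsmul_eq_mul]; push_cast; ring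
    rw [← this]
    refine sum_le_sum fun k hk => ?_
    have hk : k ≤ m := by simpa [Nat.lt_succ_iff] using hk
    have h1 : c * a ^ k ≤ f k :=
      (mul_le_mul_of_nonneg_left (pow_le_pow_left₀ ha.le haM k) hc.le).trans (hcf k)
    calc c * a ^ m = c * a ^ k * a ^ (m - k) := by
          rw [mul_assoc, ← pow_add, Nat.add_sub_cancel' hk]
      _ ≤ _ := mul_le_mul_of_nonneg_right h1 (by positivity)
  have ho : (fun m => a ^ m) =o[atTop] g := by
    rw [Asymptotics.isLittleO_iff]
    intro ε hε
    obtain ⟨N, hN⟩ := exists_nat_gt (1 / (ε * c))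
    filter_upwards [eventually_ge_atTop N] with m hm
    have hm' : (N : ℝ) ≤ m := by exact_mod_cast hm
    have hp : 0 < a ^ m := by positivity
    have hgm : 0 ≤ g m := le_trans (by positivity) (lower m)
    rw [Real.norm_eq_abs, Real.norm_eq_abs, abs_of_pos hp, abs_of_nonneg hgm]
    have h1 : 1 ≤ ε * (c * (m + 1)) := by
      rw [div_lt_iff₀ (by positivity)] at hN
      have : (N : ℝ) * (ε * c) ≤ (m + 1) * (ε * c) :=
        mul_le_mul_of_nonneg_right (by linarith) (by positivity)
      nlinarith
    calc a ^ m ≤ ε * (c * (m + 1)) * a ^ m := le_mul_of_one_le_left hp.le h1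
      _ = ε * (c * (m + 1) * a ^ m) := by ring
      _ ≤ _ := mul_le_mul_of_nonneg_left (lower m) hε.le
  refine jk_toeplitz M f (fun k => a ^ k) g hf0 (fun m => by positivity) hg hfo ?_ ?_
  · intro j
    refine (ho.const_mul_left ((a ^ j)⁻¹)).congr' ?_ EventuallyEq.rfl
    filter_upwards [eventually_ge_atTop j] with m hm
    rw [pow_sub₀ a ha.ne' hm, mul_comm]
  · refine (ho.const_mul_left a).congr_left fun m => ?_
    rw [pow_succ, mul_comm]

lemma jk_good_exp (M : ℝ) (hM : 0 < M) (r : ℝ) (hr : 0 < r) (f g : ℕ → ℝ)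
    (hf : JkGood M f)
    (hg : ∀ m, g m = ∑ k ∈ range (m + 1), f k * (r ^ (m - k) / (Nat.factorial (m - k)))) :
    JkGood M g := by
  have hl := jk_good_lower M hM f (fun k => r ^ k / (Nat.factorial k)) g hf
    (fun m => by positivity) (by simp) hg
  refine ⟨hl, ?_⟩
  obtain ⟨⟨c, hc, hcf⟩, hfo⟩ := hf
  have hf0 : ∀ m, 0 ≤ f m := fun m => le_trans (by positivity) (hcf m)
  have hO : (fun m => M ^ m) =O[atTop] g := by
    obtain ⟨c', hc', hcg⟩ := hl
    refine Asymptotics.IsBigO.of_bound (1 / c') (Eventually.of_forall fun m => ?_)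
    have hp : 0 < M ^ m := by positivity
    have hgm : 0 ≤ g m := le_trans (by positivity) (hcg m)
    rw [Real.norm_eq_abs, Real.norm_eq_abs, abs_of_pos hp, abs_of_nonneg hgm, div_mul_eq_mul_div,
      one_mul, le_div_iff₀ hc', mul_comm]
    exact hcg m
  have ho : (fun m => r ^ m / (Nat.factorial m : ℝ)) =o[atTop] (fun m => M ^ m) := by
    rw [Asymptotics.isLittleO_iff_tendsto (fun m hm => absurd hm (by positivity))]
    refine (FloorSemiring.tendsto_pow_div_factorial_atTop (r / M)).congr fun m => ?_
    rw [div_pow]; field_simp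
  refine jk_toeplitz M f (fun k => r ^ k / (Nat.factorial k)) g hf0 (fun m => by positivity) hg
    hfo ?_ ?_
  · intro j
    refine (ho.comp_tendsto (tendsto_sub_atTop_nat j)).trans_isBigO ?_
    refine Asymptotics.IsBigO.trans ?_ hO
    refine ((Asymptotics.isBigO_refl (fun m => M ^ m) atTop).const_mul_left
      ((M ^ j)⁻¹)).congr' ?_ EventuallyEq.rfl
    filter_upwards [eventually_ge_atTop j] with m hm
    simp only [Function.comp]
    rw [pow_sub₀ M hM.ne' hm, mul_comm]
  · refine (ho.comp_tendsto (tendsto_add_atTop_nat 1)).trans_isBigO ?_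
    refine Asymptotics.IsBigO.trans ?_ hO
    refine ((Asymptotics.isBigO_refl (fun m => M ^ m) atTop).const_mul_left M).congr_left
      fun m => ?_
    simp only [Function.comp]
    rw [pow_succ, mul_comm]

/-- The generating series of a node. -/
noncomputable def jkSeries {S I : Type*} (γ : S → ℝ) (ρ : I → ℝ) : S ⊕ I → PowerSeries ℝ :=
  Sum.elim (fun i => PowerSeries.mk fun k => γ i ^ k)
    (fun r => PowerSeries.mk fun k => ρ r ^ k / (Nat.factorial k))

lemma jk_eq_coeff (S I : Type*) [Fintype S] [Fintype I]
    [DecidableEq S] [DecidableEq I] (γ : S → ℝ) (ρ : I → ℝ) (m : ℕ) :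
    jacksonG S I γ ρ m = PowerSeries.coeff m (∏ v, jkSeries γ ρ v) := by
  rw [PowerSeries.coeff_prod, jacksonG]
  symm
  refine sum_bij (fun l _ => (l : S ⊕ I → ℕ)) ?_ ?_ ?_ ?_
  · intro l hl
    have hl : ∑ v, l v = m := by simpa [mem_finsuppAntidiag] using hl
    simp only [mem_filter, Fintype.mem_piFinset, mem_range, Nat.lt_succ_iff]
    refine ⟨fun v => ?_, hl⟩
    rw [← hl]
    exact single_le_sum (f := fun v => l v) (fun _ _ => Nat.zero_le _) (mem_univ v)
  · intro a _ b _ h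
    exact DFunLike.coe_injective h
  · intro b hb
    refine ⟨Finsupp.equivFunOnFinite.symm b, ?_, by simp⟩
    have := (mem_filter.1 hb).2
    simpa [mem_finsuppAntidiag] using this
  · intro l _
    rw [Fintype.prod_sum_type]
    simp [jkSeries]

lemma jk_good_prod (S I : Type*) [DecidableEq S] [DecidableEq I] (γ : S → ℝ)
    (hγ : ∀ i, 0 < γ i) (ρ : I → ℝ) (hρ : ∀ r, 0 < ρ r)
    (i₀ : S) (hmax : ∀ i, γ i ≤ γ i₀) (s : Finset (S ⊕ I)) :
    JkGood (γ i₀)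
      (fun m => PowerSeries.coeff m (jkSeries γ ρ (Sum.inl i₀) * ∏ v ∈ s, jkSeries γ ρ v)) := by
  induction s using Finset.induction_on with
  | empty =>
    refine ⟨⟨1, one_pos, fun m => by simp [jkSeries]⟩, ?_⟩
    have : (fun m : ℕ => γ i₀ ^ (m + 1) - γ i₀ * γ i₀ ^ m) = fun _ => 0 := by
      funext m; ring
    simp only [jkSeries, prod_empty, mul_one, Sum.elim_inl, PowerSeries.coeff_mk, this]
    exact Asymptotics.isLittleO_zero _ _
  | insert v s hv ih =>
    have e : ∀ m, PowerSeries.coeff m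
        (jkSeries γ ρ (Sum.inl i₀) * ∏ w ∈ insert v s, jkSeries γ ρ w) =
        ∑ k ∈ range (m + 1), PowerSeries.coeff k
          (jkSeries γ ρ (Sum.inl i₀) * ∏ w ∈ s, jkSeries γ ρ w) *
          PowerSeries.coeff (m - k) (jkSeries γ ρ v) := by
      intro m
      rw [prod_insert hv, mul_comm (jkSeries γ ρ v), ← mul_assoc, PowerSeries.coeff_mul,
        Finset.Nat.sum_antidiagonal_eq_sum_range_succ_mk]
    rcases v with i | r
    · refine jk_good_geom (γ i₀) (hγ _) (γ i) (hγ i) (hmax i) _ _ ih fun m => ?_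
      rw [e]; simp [jkSeries]
    · refine jk_good_exp (γ i₀) (hγ _) (ρ r) (hρ r) _ _ ih fun m => ?_
      rw [e]; simp [jkSeries]

/-- limiting availability without rebalancing. As `m → ∞` the ratio
`G (m-1) / G m` tends to `1 / γmax`, and hence the availability
`A i m = γ i * G (m-1) / G m` of each station tends to `γ i / γmax`. -/
theorem limiting_availability_without_rebalancing
    (S I : Type*) [Fintype S] [Nonempty S] [Fintype I]
    [DecidableEq S] [DecidableEq I]
    (γ : S → ℝ) (hγ : ∀ i, 0 < γ i)
    (ρ : I → ℝ) (hρ : ∀ r, 0 < ρ r)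
    (γmax : ℝ) (hmax_le : ∀ i, γ i ≤ γmax) (hmax_attained : ∃ i, γ i = γmax) :
    Tendsto (fun m : ℕ => jacksonG S I γ ρ (m - 1) / jacksonG S I γ ρ m)
      atTop (nhds (1 / γmax)) ∧
    ∀ i, Tendsto (fun m : ℕ => γ i * jacksonG S I γ ρ (m - 1) / jacksonG S I γ ρ m)
      atTop (nhds (γ i / γmax)) := by
  obtain ⟨i₀, rfl⟩ := hmax_attained
  have hgood : JkGood (γ i₀) (jacksonG S I γ ρ) := by
    have := jk_good_prod S I γ hγ ρ hρ i₀ hmax_le (univ.erase (Sum.inl i₀))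
    rw [mul_prod_erase univ _ (mem_univ _)] at this
    convert this using 1
    funext m
    exact jk_eq_coeff S I γ ρ m
  obtain ⟨⟨c, hc, hcG⟩, ho⟩ := hgood
  have hpos : ∀ m, 0 < jacksonG S I γ ρ m := fun m =>
    lt_of_lt_of_le (mul_pos hc (pow_pos (hγ i₀) m)) (hcG m)
  have h1 : Tendsto (fun m => jacksonG S I γ ρ (m + 1) / jacksonG S I γ ρ m) atTop
      (nhds (γ i₀)) := by
    have := ho.tendsto_div_nhds_zero.add_const (γ i₀)
    rw [zero_add] at this
    refine this.congr fun m => ?_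
    have := (hpos m).ne'
    field_simp
    ring
  have h2 : Tendsto (fun m : ℕ => jacksonG S I γ ρ (m - 1) / jacksonG S I γ ρ m)
      atTop (nhds (1 / γ i₀)) := by
    rw [← tendsto_add_atTop_iff_nat 1, one_div]
    refine (h1.inv₀ (hγ i₀).ne').congr fun m => ?_
    rw [inv_div, Nat.add_sub_cancel]
  refine ⟨h2, fun i => ?_⟩
  have h3 := h2.const_mul (γ i)
  rw [mul_one_div] at h3
  refine h3.congr fun m => ?_
  rw [mul_div_assoc]
end
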